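/- Let β ∈ (1,2] satisfy π_β((10³(110)⁴)^∞) = π_β((01⁵)^∞), i.e., the periodic sequences obtained by repeating the words 1000110110110110 and 011111 represent the same number in base β (such β ≈ 1.84408 exists). Let x := π_β((01⁵)^∞). Then every β-expansion of x has the form 𝐱₁𝐱₂⋯ where each block 𝐱_i is either the word 10³(110)⁴ = 1000110110110110 or the word 01⁵ = 011111. Consequently, x has a continuum (cardinality 2^{ℵ₀}) of distinct β-expansions, and none of them is simply normal. -/

import Mathlib

/-- `ε` is a β-expansion of `x`. -/
def isExpansion (β x : ℝ) (ε : ℕ → ℕ) : Prop :=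
  (∀ i, ε i ≤ 1) ∧ x = ∑' i : ℕ, (ε i : ℝ) / β ^ (i + 1)

/-- A {0,1}-sequence is simply normal if the frequency of zeros tends to 1/2. -/
def simplyNormal (ε : ℕ → ℕ) : Prop :=
  Filter.Tendsto
    (fun n => (((Finset.range n).filter fun i => ε i = 0).card : ℝ) / n)
    Filter.atTop (nhds (1 / 2))

/-- The word `10³(110)⁴ = 1000110110110110`. -/
def wordA : List ℕ := [1, 0, 0, 0, 1, 1, 0, 1, 1, 0, 1, 1, 0, 1, 1, 0]

/-- The word `01⁵ = 011111`. -/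
def wordB : List ℕ := [0, 1, 1, 1, 1, 1]

/-- The value in base β of the periodic sequence `w^∞`. -/
noncomputable def piPeriodic (β : ℝ) (w : List ℕ) : ℝ :=
  ∑' i : ℕ, (w.getD (i % w.length) 0 : ℝ) / β ^ (i + 1)

/-- The starting index of the `n`-th block in the concatenation of `blocks`. -/
def blockStart (blocks : ℕ → List ℕ) (n : ℕ) : ℕ :=
  ∑ i ∈ Finset.range n, (blocks i).length

/-- `ε` is the infinite concatenation of the finite words `blocks 0, blocks 1, …`. -/
def isConcatenation (ε : ℕ → ℕ) (blocks : ℕ → List ℕ) : Prop :=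
  ∀ n : ℕ, ∀ m < (blocks n).length,
    ε (blockStart blocks n + m) = (blocks n).getD m 0

/-- The value of the `n`-th tail of `ε` in base `β`. -/
noncomputable def tailVal (β : ℝ) (ε : ℕ → ℕ) (n : ℕ) : ℝ :=
  ∑' i : ℕ, (ε (n + i) : ℝ) / β ^ (i + 1)

lemma geo_hasSum {β : ℝ} (hb : 1 < β) :
    HasSum (fun i : ℕ => 1 / β ^ (i + 1)) (1 / (β - 1)) := by
  have h := (hasSum_geometric_of_lt_one (r := β⁻¹) (by positivity)
    (inv_lt_one_of_one_lt₀ hb)).mul_left β⁻¹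
  have h0 : β ≠ 0 := by positivity
  have h1 : β - 1 ≠ 0 := by linarith
  have e1 : (fun i : ℕ => 1 / β ^ (i + 1)) = fun i : ℕ => β⁻¹ * β⁻¹ ^ i := by
    funext i
    rw [← pow_succ', one_div, inv_pow]
  have e2 : 1 / (β - 1) = β⁻¹ * (1 - β⁻¹)⁻¹ := by
    rw [← mul_inv, mul_sub, mul_inv_cancel₀ h0, mul_one, one_div]
  rw [e1, e2]
  exact h

lemma digit_summable {β : ℝ} (hb : 1 < β) {ε : ℕ → ℕ} (he : ∀ i, ε i ≤ 1) (n : ℕ) :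
    Summable (fun i : ℕ => (ε (n + i) : ℝ) / β ^ (i + 1)) := by
  refine Summable.of_nonneg_of_le (fun i => by positivity) (fun i => ?_) (geo_hasSum hb).summable
  have : (ε (n + i) : ℝ) ≤ 1 := by exact_mod_cast he _
  gcongr

lemma tailVal_nonneg {β : ℝ} (hb : 1 < β) (ε : ℕ → ℕ) (n : ℕ) : 0 ≤ tailVal β ε n :=
  tsum_nonneg (fun i => by positivity)

lemma tailVal_le {β : ℝ} (hb : 1 < β) {ε : ℕ → ℕ} (he : ∀ i, ε i ≤ 1) (n : ℕ) :
    tailVal β ε n ≤ 1 / (β - 1) := by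
  rw [← (geo_hasSum hb).tsum_eq]
  refine Summable.tsum_le_tsum (fun i => ?_) (digit_summable hb he n) (geo_hasSum hb).summable
  have : (ε (n + i) : ℝ) ≤ 1 := by exact_mod_cast he _
  gcongr

lemma tailVal_step {β : ℝ} (hb : 1 < β) {ε : ℕ → ℕ} (he : ∀ i, ε i ≤ 1) (n : ℕ) :
    tailVal β ε (n + 1) = β * tailVal β ε n - ε n := by
  have h0 : β ≠ 0 := by positivity
  have h : tailVal β ε n = (ε n : ℝ) / β + tailVal β ε (n + 1) / β := by
    unfold tailVal
    rw [(digit_summable hb he n).tsum_eq_zero_add, ← tsum_div_const]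
    congr 1
    · simp
    · refine tsum_congr fun i => ?_
      rw [show n + (i + 1) = n + 1 + i by ring, pow_succ β (i + 1), div_div]
  rw [h]
  field_simp
  ring

lemma tailVal_congr {β : ℝ} {ε δ : ℕ → ℕ} {n m : ℕ} (h : ∀ i, ε (n + i) = δ (m + i)) :
    tailVal β ε n = tailVal β δ m := by
  unfold tailVal
  exact tsum_congr fun i => by rw [h]

/-- The periodic sequence of a word. -/
def perSeq (w : List ℕ) (i : ℕ) : ℕ := w.getD (i % w.length) 0

lemma piPeriodic_eq (β : ℝ) (w : List ℕ) : piPeriodic β w = tailVal β (perSeq w) 0 := by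
  unfold piPeriodic tailVal perSeq
  simp

lemma perA_le (i : ℕ) : perSeq wordA i ≤ 1 := by
  have : ∀ j < 16, wordA.getD j 0 ≤ 1 := by decide
  exact this _ (Nat.mod_lt _ (by decide))

lemma perB_le (i : ℕ) : perSeq wordB i ≤ 1 := by
  have : ∀ j < 6, wordB.getD j 0 ≤ 1 := by decide
  exact this _ (Nat.mod_lt _ (by decide))

lemma perB_eq {β : ℝ} (hb : 1 < β) :
    piPeriodic β wordB * (β ^ 6 - 1) = β ^ 4 + β ^ 3 + β ^ 2 + β + 1 := by
  rw [piPeriodic_eq]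
  have hper : tailVal β (perSeq wordB) 6 = tailVal β (perSeq wordB) 0 :=
    tailVal_congr fun i => by simp [perSeq, wordB]
  have s := tailVal_step hb perB_le
  have s0 := s 0
  have s1 := s 1
  have s2 := s 2
  have s3 := s 3
  have s4 := s 4
  have s5 := s 5
  simp only [perSeq, wordB] at s0 s1 s2 s3 s4 s5
  norm_num at s0 s1 s2 s3 s4 s5
  change _ = tailVal β (perSeq wordB) 0 at hper
  simp only [wordB] at hper ⊢
  rw [s5, s4, s3, s2, s1, s0] at hper
  linear_combination hper

lemma perA_eq {β : ℝ} (hb : 1 < β) :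
    piPeriodic β wordA * (β ^ 16 - 1) = β ^ 15 + β ^ 11 + β ^ 10 + β ^ 8 + β ^ 7 + β ^ 5 + β ^ 4
      + β ^ 2 + β := by
  rw [piPeriodic_eq]
  have hper : tailVal β (perSeq wordA) 16 = tailVal β (perSeq wordA) 0 :=
    tailVal_congr fun i => by simp [perSeq, wordA]
  have s := tailVal_step hb perA_le
  generalize hT : tailVal β (perSeq wordA) = T at *
  have s0 := s 0
  have s1 := s 1
  have s2 := s 2
  have s3 := s 3
  have s4 := s 4
  have s5 := s 5
  have s6 := s 6
  have s7 := s 7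
  have s8 := s 8
  have s9 := s 9
  have s10 := s 10
  have s11 := s 11
  have s12 := s 12
  have s13 := s 13
  have s14 := s 14
  have s15 := s 15
  norm_num [perSeq, wordA] at s0 s1 s2 s3 s4 s5 s6 s7 s8 s9 s10 s11 s12 s13 s14 s15
  rw [s15, s14, s13, s12, s11, s10, s9, s8, s7, s6, s5, s4, s3, s2, s1, s0] at hper
  linear_combination hper

/-- Numerical bounds for the reciprocal of the base. -/
lemma u_bounds {u x : ℝ} (h0 : 0 < u) (h1 : u < 1)
    (hB : x * (1 - u ^ 6) = u ^ 2 + u ^ 3 + u ^ 4 + u ^ 5 + u ^ 6)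
    (hA : x * (1 - u ^ 16) = u + u ^ 5 + u ^ 6 + u ^ 8 + u ^ 9 + u ^ 11 + u ^ 12 + u ^ 14 + u ^ 15) :
    0.542275587603 < u ∧ u < 0.542275587605 := by
  have hG : u ^ 2 + 2 * u ^ 3 + 2 * u ^ 4 + 2 * u ^ 5 + 3 * u ^ 6 + 2 * u ^ 7 + u ^ 8 + u ^ 9
      + u ^ 10 + u ^ 11 + u ^ 12 + u ^ 13 + u ^ 14 + u ^ 15 + 2 * u ^ 16 + 2 * u ^ 17 + u ^ 18
      + u ^ 19 + u ^ 20 = 1 := by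
    have hne : u * (1 - u) ≠ 0 := by
      have : 0 < 1 - u := by linarith
      positivity
    apply mul_left_cancel₀ hne
    linear_combination (1 - u ^ 6) * hA - (1 - u ^ 16) * hB
  constructor
  · by_contra! hc
    have : u ^ 2 + 2 * u ^ 3 + 2 * u ^ 4 + 2 * u ^ 5 + 3 * u ^ 6 + 2 * u ^ 7 + u ^ 8 + u ^ 9
      + u ^ 10 + u ^ 11 + u ^ 12 + u ^ 13 + u ^ 14 + u ^ 15 + 2 * u ^ 16 + 2 * u ^ 17 + u ^ 18
      + u ^ 19 + u ^ 20 < 1 := by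
      generalize hc' : (0.542275587603 : ℝ) = c at hc
      calc _ ≤ c ^ 2 + 2 * c ^ 3 + 2 * c ^ 4 + 2 * c ^ 5 + 3 * c ^ 6 + 2 * c ^ 7 + c ^ 8 + c ^ 9
            + c ^ 10 + c ^ 11 + c ^ 12 + c ^ 13 + c ^ 14 + c ^ 15 + 2 * c ^ 16 + 2 * c ^ 17 + c ^ 18
            + c ^ 19 + c ^ 20 := by gcongr
        _ < 1 := by rw [← hc']; norm_num
    linarith
  · by_contra! hc
    have : 1 < u ^ 2 + 2 * u ^ 3 + 2 * u ^ 4 + 2 * u ^ 5 + 3 * u ^ 6 + 2 * u ^ 7 + u ^ 8 + u ^ 9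
      + u ^ 10 + u ^ 11 + u ^ 12 + u ^ 13 + u ^ 14 + u ^ 15 + 2 * u ^ 16 + 2 * u ^ 17 + u ^ 18
      + u ^ 19 + u ^ 20 := by
      generalize hc' : (0.542275587605 : ℝ) = c at hc
      have hc0 : 0 < c := by rw [← hc']; norm_num
      calc 1 < c ^ 2 + 2 * c ^ 3 + 2 * c ^ 4 + 2 * c ^ 5 + 3 * c ^ 6 + 2 * c ^ 7 + c ^ 8 + c ^ 9
            + c ^ 10 + c ^ 11 + c ^ 12 + c ^ 13 + c ^ 14 + c ^ 15 + 2 * c ^ 16 + 2 * c ^ 17 + c ^ 18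
            + c ^ 19 + c ^ 20 := by rw [← hc']; norm_num
        _ ≤ _ := by gcongr
    linarith

/-- All the information about the base and the point that is used afterwards. -/
structure Setup (β x : ℝ) : Prop where
  one_lt : 1 < β
  lb : 1.844080801080 ≤ β
  ub : β ≤ 1.844080801100
  eqB : x * (β ^ 6 - 1) = β ^ 4 + β ^ 3 + β ^ 2 + β + 1
  eqA : x * (β ^ 16 - 1) = β ^ 15 + β ^ 11 + β ^ 10 + β ^ 8 + β ^ 7 + β ^ 5 + β ^ 4 + β ^ 2 + β
  xl : 6282960856 / 10000000000 ≤ x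
  xh : x ≤ 6282960857 / 10000000000

lemma setup_of {β : ℝ} (hb : 1 < β) (hc : piPeriodic β wordA = piPeriodic β wordB) :
    Setup β (piPeriodic β wordB) := by
  have eB := perB_eq hb
  have eA := perA_eq hb
  rw [hc] at eA
  generalize piPeriodic β wordB = x at *
  have h0 : 0 < β := by linarith
  have hu0 : 0 < β⁻¹ := by positivity
  have hu1 : β⁻¹ < 1 := inv_lt_one_of_one_lt₀ hb
  obtain ⟨u, hu⟩ : ∃ u, u = β⁻¹ := ⟨_, rfl⟩
  have hβ : β = u⁻¹ := by rw [hu, inv_inv]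
  rw [← hu] at hu0 hu1
  have une : u ≠ 0 := hu0.ne'
  have hB : x * (1 - u ^ 6) = u ^ 2 + u ^ 3 + u ^ 4 + u ^ 5 + u ^ 6 := by
    have := eB
    rw [hβ] at this
    field_simp at this
    linear_combination this
  have hA : x * (1 - u ^ 16) = u + u ^ 5 + u ^ 6 + u ^ 8 + u ^ 9 + u ^ 11 + u ^ 12 + u ^ 14
      + u ^ 15 := by
    have := eA
    rw [hβ] at this
    field_simp at this
    linear_combination this
  obtain ⟨l, h⟩ := u_bounds hu0 hu1 hB hA
  have hl6 : (0.542275587603 : ℝ) ^ 2 ≤ u ^ 2 := by gcongr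
  have p : ∀ k : ℕ, (0.542275587603 : ℝ) ^ k ≤ u ^ k := fun k => by gcongr
  have q : ∀ k : ℕ, u ^ k ≤ (0.542275587605 : ℝ) ^ k := fun k => by gcongr
  have p2 := p 2
  have p3 := p 3
  have p4 := p 4
  have p5 := p 5
  have p6 := p 6
  have q2 := q 2
  have q3 := q 3
  have q4 := q 4
  have q5 := q 5
  have q6 := q 6
  have hpos : 0 < 1 - u ^ 6 := by norm_num at q6 ⊢; linarith
  refine ⟨hb, ?_, ?_, eB, eA, ?_, ?_⟩
  · rw [hβ]
    rw [le_inv_comm₀ (by norm_num) hu0]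
    refine h.le.trans (by norm_num)
  · rw [hβ]
    rw [inv_le_comm₀ hu0 (by norm_num)]
    refine le_trans (by norm_num) l.le
  · by_contra! hx
    have := mul_lt_mul_of_pos_right hx hpos
    norm_num at *
    linarith
  · by_contra! hx
    have := mul_lt_mul_of_pos_right hx hpos
    norm_num at *
    linarith

section steps
variable {β x : ℝ} {ε : ℕ → ℕ}

lemma step_num (hS : Setup β x) (he : ∀ i, ε i ≤ 1) {n d : ℕ} {l h l' h' : ℝ}
    (hl : l ≤ tailVal β ε n) (hh : tailVal β ε n ≤ h) (e : ε n = d)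
    (l0 : 0 ≤ l) (h1 : l' ≤ 1.844080801080 * l - d) (h2 : 1.844080801100 * h - d ≤ h') :
    l' ≤ tailVal β ε (n + 1) ∧ tailVal β ε (n + 1) ≤ h' := by
  rw [tailVal_step hS.one_lt he, e]
  have a := hS.lb
  have b := hS.ub
  have c := hS.one_lt
  have h3 : 1.844080801080 * l ≤ β * tailVal β ε n := by gcongr
  have h4 : β * tailVal β ε n ≤ 1.844080801100 * h := by
    have := l0.trans hl
    gcongr
  constructor <;> linarith

lemma step0 (hS : Setup β x) (he : ∀ i, ε i ≤ 1) {n : ℕ} {l h l' h' : ℝ}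
    (l0 : 0 ≤ l) (h0 : 1.844080801100 * h < 1) (h1 : l' ≤ 1.844080801080 * l - (0 : ℕ))
    (h2 : 1.844080801100 * h - (0 : ℕ) ≤ h')
    (hl : l ≤ tailVal β ε n) (hh : tailVal β ε n ≤ h) :
    ε n = 0 ∧ l' ≤ tailVal β ε (n + 1) ∧ tailVal β ε (n + 1) ≤ h' := by
  have e : ε n = 0 := by
    by_contra hne
    have e : ε n = 1 := by have := he n; omega
    have := (step_num hS he hl hh e l0 le_rfl le_rfl).2
    have h3 := tailVal_nonneg hS.one_lt ε (n + 1)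
    push_cast at this
    linarith
  exact ⟨e, step_num hS he hl hh e l0 h1 h2⟩

lemma step1 (hS : Setup β x) (he : ∀ i, ε i ≤ 1) {n : ℕ} {l h l' h' : ℝ}
    (l0 : 0 ≤ l) (h0 : 1.185 < 1.844080801080 * l) (h1 : l' ≤ 1.844080801080 * l - (1 : ℕ))
    (h2 : 1.844080801100 * h - (1 : ℕ) ≤ h')
    (hl : l ≤ tailVal β ε n) (hh : tailVal β ε n ≤ h) :
    ε n = 1 ∧ l' ≤ tailVal β ε (n + 1) ∧ tailVal β ε (n + 1) ≤ h' := by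
  have e : ε n = 1 := by
    by_contra hne
    have e : ε n = 0 := by have := he n; omega
    have := (step_num hS he hl hh e l0 le_rfl le_rfl).1
    have h3 := tailVal_le hS.one_lt he (n + 1)
    have h4 : 1 / (β - 1) ≤ 1.185 := by
      have := hS.lb
      rw [div_le_iff₀ (by linarith)]
      linarith
    push_cast at this
    linarith
  exact ⟨e, step_num hS he hl hh e l0 h1 h2⟩

lemma block_B (hS : Setup β x) (he : ∀ i, ε i ≤ 1) {n : ℕ} (hn : tailVal β ε n = x)
    (e0 : ε n = 0) : (∀ m < 6, ε (n + m) = wordB.getD m 0) ∧ tailVal β ε (n + 6) = x := by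
  have hl0 : _ ≤ tailVal β ε n := hn ▸ hS.xl
  have hh0 : tailVal β ε n ≤ _ := hn ▸ hS.xh
  obtain ⟨hl1, hh1⟩ := step_num hS he (l' := (11586287488/10000000000))
    (h' := (11586287491/10000000000)) hl0 hh0 e0
    (by norm_num) (by norm_num) (by norm_num)
  obtain ⟨e1, hl2, hh2⟩ := step1 hS he (n := n + 1) (l' := (11366050312/10000000000))
    (h' := (11366050319/10000000000)) (by norm_num) (by norm_num) (by norm_num) (by norm_num) hl1 hh1
  obtain ⟨e2, hl3, hh3⟩ := step1 hS he (n := n + 2) (l' := (10959915164/10000000000))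
    (h' := (10959915178/10000000000)) (by norm_num) (by norm_num) (by norm_num) (by norm_num) hl2 hh2
  obtain ⟨e3, hl4, hh4⟩ := step1 hS he (n := n + 3) (l' := (10210969135/10000000000))
    (h' := (10210969162/10000000000)) (by norm_num) (by norm_num) (by norm_num) (by norm_num) hl3 hh3
  obtain ⟨e4, hl5, hh5⟩ := step1 hS he (n := n + 4) (l' := (8829852142/10000000000))
    (h' := (8829852193/10000000000)) (by norm_num) (by norm_num) (by norm_num) (by norm_num) hl4 hh4
  obtain ⟨e5, hl6, hh6⟩ := step1 hS he (n := n + 5) (l' := (6282960811/10000000000))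
    (h' := (6282960906/10000000000)) (by norm_num) (by norm_num) (by norm_num) (by norm_num) hl5 hh5
  constructor
  · intro m hm
    interval_cases m <;> simp [wordB, *]
  · have s := tailVal_step hS.one_lt he
    have eB := hS.eqB
    rw [s (n + 5), s (n + 4), s (n + 3), s (n + 2), s (n + 1), s n, hn, e0, e1, e2, e3, e4, e5]
    push_cast
    linear_combination eB

lemma block_A (hS : Setup β x) (he : ∀ i, ε i ≤ 1) {n : ℕ} (hn : tailVal β ε n = x)
    (e0 : ε n = 1) : (∀ m < 16, ε (n + m) = wordA.getD m 0) ∧ tailVal β ε (n + 16) = x := by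
  have hl0 : _ ≤ tailVal β ε n := hn ▸ hS.xl
  have hh0 : tailVal β ε n ≤ _ := hn ▸ hS.xh
  obtain ⟨hl1, hh1⟩ := step_num hS he (l' := (1586287488/10000000000))
    (h' := (1586287491/10000000000)) hl0 hh0 e0
    (by norm_num) (by norm_num) (by norm_num)
  obtain ⟨e1, hl2, hh2⟩ := step0 hS he (n := n + 1) (l' := (2925242301/10000000000))
    (h' := (2925242308/10000000000)) (by norm_num) (by norm_num) (by norm_num) (by norm_num) hl1 hh1
  obtain ⟨e2, hl3, hh3⟩ := step0 hS he (n := n + 2) (l' := (5394383165/10000000000))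
    (h' := (5394383179/10000000000)) (by norm_num) (by norm_num) (by norm_num) (by norm_num) hl2 hh2
  obtain ⟨e3, hl4, hh4⟩ := step0 hS he (n := n + 3) (l' := (9947678428/10000000000))
    (h' := (9947678455/10000000000)) (by norm_num) (by norm_num) (by norm_num) (by norm_num) hl3 hh3
  obtain ⟨e4, hl5, hh5⟩ := step1 hS he (n := n + 4) (l' := (8344322804/10000000000))
    (h' := (8344322855/10000000000)) (by norm_num) (by norm_num) (by norm_num) (by norm_num) hl4 hh4
  obtain ⟨e5, hl6, hh6⟩ := step1 hS he (n := n + 5) (l' := (5387605480/10000000000))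
    (h' := (5387605576/10000000000)) (by norm_num) (by norm_num) (by norm_num) (by norm_num) hl5 hh5
  obtain ⟨e6, hl7, hh7⟩ := step0 hS he (n := n + 6) (l' := (9935179829/10000000000))
    (h' := (9935180007/10000000000)) (by norm_num) (by norm_num) (by norm_num) (by norm_num) hl6 hh6
  obtain ⟨e7, hl8, hh8⟩ := step1 hS he (n := n + 7) (l' := (8321274377/10000000000))
    (h' := (8321274707/10000000000)) (by norm_num) (by norm_num) (by norm_num) (by norm_num) hl7 hh7
  obtain ⟨e8, hl9, hh9⟩ := step1 hS he (n := n + 8) (l' := (5345102319/10000000000))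
    (h' := (5345102928/10000000000)) (by norm_num) (by norm_num) (by norm_num) (by norm_num) hl8 hh8
  obtain ⟨e9, hl10, hh10⟩ := step0 hS he (n := n + 9) (l' := (9856800566/10000000000))
    (h' := (9856801690/10000000000)) (by norm_num) (by norm_num) (by norm_num) (by norm_num) hl9 hh9
  obtain ⟨e10, hl11, hh11⟩ := step1 hS he (n := n + 10) (l' := (8176736683/10000000000))
    (h' := (8176738757/10000000000)) (by norm_num) (by norm_num) (by norm_num) (by norm_num) hl10 hh10
  obtain ⟨e11, hl12, hh12⟩ := step1 hS he (n := n + 11) (l' := (5078563132/10000000000))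
    (h' := (5078566958/10000000000)) (by norm_num) (by norm_num) (by norm_num) (by norm_num) hl11 hh11
  obtain ⟨e12, hl13, hh13⟩ := step0 hS he (n := n + 12) (l' := (9365280768/10000000000))
    (h' := (9365287825/10000000000)) (by norm_num) (by norm_num) (by norm_num) (by norm_num) hl12 hh12
  obtain ⟨e13, hl14, hh14⟩ := step1 hS he (n := n + 13) (l' := (7270334460/10000000000))
    (h' := (7270347475/10000000000)) (by norm_num) (by norm_num) (by norm_num) (by norm_num) hl13 hh13
  obtain ⟨e14, hl15, hh15⟩ := step1 hS he (n := n + 14) (l' := (3407084195/10000000000))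
    (h' := (3407108196/10000000000)) (by norm_num) (by norm_num) (by norm_num) (by norm_num) hl14 hh14
  obtain ⟨e15, hl16, hh16⟩ := step0 hS he (n := n + 15) (l' := (6282938551/10000000000))
    (h' := (6282982812/10000000000)) (by norm_num) (by norm_num) (by norm_num) (by norm_num) hl15 hh15
  constructor
  · intro m hm
    interval_cases m <;> simp [wordA, *]
  · have s := tailVal_step hS.one_lt he
    have eA := hS.eqA
    rw [s (n + 15), s (n + 14), s (n + 13), s (n + 12), s (n + 11), s (n + 10), s (n + 9),
      s (n + 8), s (n + 7), s (n + 6), s (n + 5), s (n + 4), s (n + 3), s (n + 2), s (n + 1), s n,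
      hn, e0, e1, e2, e3, e4, e5, e6, e7, e8, e9, e10, e11, e12, e13, e14, e15]
    push_cast
    linear_combination eA

end steps

/-- The starting positions of the blocks. -/
def blkPos (ε : ℕ → ℕ) : ℕ → ℕ
  | 0 => 0
  | k + 1 => if ε (blkPos ε k) = 1 then blkPos ε k + 16 else blkPos ε k + 6

lemma blocks_exist {β x : ℝ} {ε : ℕ → ℕ} (hS : Setup β x) (he : ∀ i, ε i ≤ 1)
    (h0 : tailVal β ε 0 = x) :
    ∃ blocks : ℕ → List ℕ,
        (∀ n, blocks n = wordA ∨ blocks n = wordB) ∧ isConcatenation ε blocks := by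
  have hval : ∀ k, tailVal β ε (blkPos ε k) = x := by
    intro k
    induction k with
    | zero => exact h0
    | succ k ih =>
      rw [blkPos]
      split_ifs with h
      · exact (block_A hS he ih h).2
      · exact (block_B hS he ih (by have := he (blkPos ε k); omega)).2
  let bl : ℕ → List ℕ := fun k => if ε (blkPos ε k) = 1 then wordA else wordB
  have hstart : ∀ k, blockStart bl k = blkPos ε k := by
    intro k
    induction k with
    | zero => simp [blockStart, blkPos]
    | succ k ih =>
      rw [blockStart, Finset.sum_range_succ, ← blockStart, ih, blkPos]
      simp only [bl]
      split_ifs <;> rfl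
  refine ⟨bl, fun n => ?_, fun n m hm => ?_⟩
  · simp only [bl]
    split_ifs <;> simp
  · rw [hstart]
    by_cases h : ε (blkPos ε n) = 1
    · simp only [bl, h, if_true] at hm ⊢
      exact (block_A hS he (hval n) h).1 m hm
    · simp only [bl, h, if_false] at hm ⊢
      exact (block_B hS he (hval n) (by have := he (blkPos ε n); omega)).1 m hm

lemma not_normal {ε : ℕ → ℕ} {blocks : ℕ → List ℕ}
    (hb : ∀ n, blocks n = wordA ∨ blocks n = wordB) (hc : isConcatenation ε blocks) :
    ¬ simplyNormal ε := by
  intro hN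
  have hsucc : ∀ k, blockStart blocks (k + 1) = blockStart blocks k + (blocks k).length := by
    intro k
    rw [blockStart, Finset.sum_range_succ, ← blockStart]
  have hge : ∀ k, k ≤ blockStart blocks k := by
    intro k
    induction k with
    | zero => simp
    | succ k ih =>
      rw [hsucc]
      rcases hb k with h | h <;> rw [h] <;> simp [wordA, wordB] <;> omega
  have hcount : ∀ k, 16 * ((Finset.range (blockStart blocks k)).filter fun i => ε i = 0).card
      ≤ 7 * blockStart blocks k := by
    intro k
    induction k with
    | zero => simp [blockStart]
    | succ k ih =>
      have hk := hc k
      rw [hsucc]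
      simp only [Finset.card_filter] at ih ⊢
      rw [Finset.sum_range_add]
      have e : ∑ m ∈ Finset.range (blocks k).length,
          (if ε (blockStart blocks k + m) = 0 then 1 else 0)
          = ∑ m ∈ Finset.range (blocks k).length, (if (blocks k).getD m 0 = 0 then 1 else 0) :=
        Finset.sum_congr rfl fun m hm => by rw [hk m (Finset.mem_range.1 hm)]
      have e2 : 16 * ∑ m ∈ Finset.range (blocks k).length,
          (if (blocks k).getD m 0 = 0 then 1 else 0) ≤ 7 * (blocks k).length := by
        rcases hb k with h | h <;> rw [h] <;> decide
      omega
  have ht : Filter.Tendsto (blockStart blocks) Filter.atTop Filter.atTop :=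
    Filter.tendsto_atTop_mono hge Filter.tendsto_id
  have hle := le_of_tendsto (b := (7 / 16 : ℝ)) (hN.comp ht) (by
    filter_upwards [Filter.eventually_gt_atTop 0] with k hk
    have hpos : (0 : ℝ) < blockStart blocks k := by exact_mod_cast hk.trans_le (hge k)
    simp only [Function.comp]
    rw [div_le_iff₀ hpos]
    have : (16 : ℝ) * ((Finset.range (blockStart blocks k)).filter fun i => ε i = 0).card
      ≤ 7 * blockStart blocks k := by exact_mod_cast hcount k
    linarith)
  norm_num at hle

/-- The sequence made of the blocks `AB` and `BA` selected by `f`. -/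
def mixSeq (f : ℕ → Bool) (i : ℕ) : ℕ :=
  (if f (i / 22) then wordA ++ wordB else wordB ++ wordA).getD (i % 22) 0

lemma mixSeq_le (f : ℕ → Bool) (i : ℕ) : mixSeq f i ≤ 1 := by
  have h1 : ∀ j < 22, (wordA ++ wordB).getD j 0 ≤ 1 := by decide
  have h2 : ∀ j < 22, (wordB ++ wordA).getD j 0 ≤ 1 := by decide
  have h := Nat.mod_lt i (show 22 > 0 by norm_num)
  unfold mixSeq
  split_ifs
  · exact h1 _ h
  · exact h2 _ h

lemma mixSeq_digit (f : ℕ → Bool) (k j : ℕ) (hj : j < 22) : mixSeq f (22 * k + j) =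
    (if f k then wordA ++ wordB else wordB ++ wordA).getD j 0 := by
  unfold mixSeq
  rw [show (22 * k + j) / 22 = k by omega, show (22 * k + j) % 22 = j by omega]

lemma mixSeq_inj : Function.Injective mixSeq := by
  intro f g h
  funext k
  have := congrFun h (22 * k + 0)
  rw [mixSeq_digit _ _ _ (by norm_num), mixSeq_digit _ _ _ (by norm_num)] at this
  cases hf : f k <;> cases hg : g k <;> simp [hf, hg, wordA, wordB] at this ⊢

lemma mixSeq_super {β x : ℝ} (hS : Setup β x) (f : ℕ → Bool) (k : ℕ) :
    tailVal β (mixSeq f) (22 * (k + 1)) - x = β ^ 22 * (tailVal β (mixSeq f) (22 * k) - x) := by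
  have s := tailVal_step hS.one_lt (mixSeq_le f)
  have d := mixSeq_digit f k
  have eA := hS.eqA
  have eB := hS.eqB
  generalize tailVal β (mixSeq f) = T at *
  generalize mixSeq f = δ at *
  rw [show 22 * (k + 1) = 22 * k + 22 by ring]
  have d0 := d 0 (by norm_num)
  rw [add_zero] at d0
  rw [s (22 * k + 21), s (22 * k + 20), s (22 * k + 19), s (22 * k + 18), s (22 * k + 17),
    s (22 * k + 16), s (22 * k + 15), s (22 * k + 14), s (22 * k + 13), s (22 * k + 12),
    s (22 * k + 11), s (22 * k + 10), s (22 * k + 9), s (22 * k + 8), s (22 * k + 7),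
    s (22 * k + 6), s (22 * k + 5), s (22 * k + 4), s (22 * k + 3), s (22 * k + 2),
    s (22 * k + 1), s (22 * k), d0, d 1 (by norm_num), d 2 (by norm_num), d 3 (by norm_num),
    d 4 (by norm_num), d 5 (by norm_num), d 6 (by norm_num), d 7 (by norm_num),
    d 8 (by norm_num), d 9 (by norm_num), d 10 (by norm_num), d 11 (by norm_num),
    d 12 (by norm_num), d 13 (by norm_num), d 14 (by norm_num), d 15 (by norm_num),
    d 16 (by norm_num), d 17 (by norm_num), d 18 (by norm_num), d 19 (by norm_num),
    d 20 (by norm_num), d 21 (by norm_num)]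
  cases f k
  · simp [wordA, wordB]
    linear_combination β ^ 16 * eB + eA
  · simp [wordA, wordB]
    linear_combination β ^ 6 * eA + eB

lemma mixSeq_val {β x : ℝ} (hS : Setup β x) (f : ℕ → Bool) : tailVal β (mixSeq f) 0 = x := by
  have h : ∀ k, tailVal β (mixSeq f) (22 * k) - x
      = (β ^ 22) ^ k * (tailVal β (mixSeq f) 0 - x) := by
    intro k
    induction k with
    | zero => simp
    | succ k ih => rw [mixSeq_super hS, ih]; ring
  by_contra hne
  have hpos : 0 < |tailVal β (mixSeq f) 0 - x| := abs_pos.2 (sub_ne_zero.2 hne)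
  have hb := hS.one_lt
  have h22 : 1 < β ^ 22 := one_lt_pow₀ hb (by norm_num)
  obtain ⟨k, hk⟩ := pow_unbounded_of_one_lt
    ((1 / (β - 1) + |x|) / |tailVal β (mixSeq f) 0 - x|) h22
  rw [div_lt_iff₀ hpos] at hk
  have h1 := congrArg abs (h k)
  rw [abs_mul, abs_of_pos (by positivity : 0 < (β ^ 22) ^ k)] at h1
  have h2 := abs_sub (tailVal β (mixSeq f) (22 * k)) x
  rw [abs_of_nonneg (tailVal_nonneg hb _ _)] at h2
  have h3 := tailVal_le hb (mixSeq_le f) (22 * k)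
  linarith


theorem continuum_expansions_none_simply_normal
    (β : ℝ) (hβ : β ∈ Set.Ioc (1 : ℝ) 2)
    (hcoincide : piPeriodic β wordA = piPeriodic β wordB) :
    (∀ ε : ℕ → ℕ, isExpansion β (piPeriodic β wordB) ε →
      ∃ blocks : ℕ → List ℕ,
        (∀ n, blocks n = wordA ∨ blocks n = wordB) ∧ isConcatenation ε blocks) ∧
    Cardinal.mk {ε : ℕ → ℕ | isExpansion β (piPeriodic β wordB) ε}
      = Cardinal.continuum ∧
    ∀ ε : ℕ → ℕ, isExpansion β (piPeriodic β wordB) ε → ¬ simplyNormal ε := by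
  have hS := setup_of hβ.1 hcoincide
  have key : ∀ ε : ℕ → ℕ, isExpansion β (piPeriodic β wordB) ε →
      ∃ blocks : ℕ → List ℕ,
        (∀ n, blocks n = wordA ∨ blocks n = wordB) ∧ isConcatenation ε blocks := by
    rintro ε ⟨he, hx⟩
    refine blocks_exist hS he ?_
    rw [hx]
    simp [tailVal]
  refine ⟨key, ?_, ?_⟩
  · apply le_antisymm
    · refine (Cardinal.mk_set_le _).trans ?_
      simp
    · have hinj : Function.Injective (fun f : ℕ → Bool =>
          (⟨mixSeq f, mixSeq_le f, by
            rw [← mixSeq_val hS f]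
            simp [tailVal]⟩ : {ε : ℕ → ℕ | isExpansion β (piPeriodic β wordB) ε})) := by
        intro f g h
        exact mixSeq_inj (congrArg Subtype.val h)
      have := Cardinal.mk_le_of_injective hinj
      have hc : Cardinal.mk (ℕ → Bool) = Cardinal.continuum := by simp
      rw [hc] at this
      exact this
  · intro ε h
    obtain ⟨bl, h1, h2⟩ := key ε h
    exact not_normal h1 h2
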